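/- Let S be a surface with nonempty boundary and no boundary isolating curve, let φ : S → Γ be a proper deformation retraction of S onto a graph Γ ⊆ S (meaning the time-one map of a proper deformation retraction), and let ψ be the inclusion Γ ↪ S. Let B be the collection of maps obtained by restricting φ to parametrizations of the boundary components of S (each compact boundary component being parametrized by S¹ and each noncompact one properly by ℝ). Then the image of Θ : Map(S) → Map(Γ) is contained in Map(Γ,B), and the image of Θ̃ : ExMap(S) → Map(Γ) is contained in Map*(Γ,B). -/

import Mathlib

open Set Topology unitInterval

noncomputable section

/-- A map is proper-continuous: continuous and the preimage of every compact set is compact. -/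
def ProperCont {X Y : Type*} [TopologicalSpace X] [TopologicalSpace Y] (f : X → Y) : Prop :=
  Continuous f ∧ ∀ K : Set Y, IsCompact K → IsCompact (f ⁻¹' K)

/-- `f` and `g` are homotopic. -/
def Htpc {X Y : Type*} [TopologicalSpace X] [TopologicalSpace Y] (f g : X → Y) : Prop :=
  ∃ H : X × I → Y, Continuous H ∧ (∀ x, H (x, 0) = f x) ∧ (∀ x, H (x, 1) = g x)

/-- `f` and `g` are properly homotopic: joined by a homotopy which is itself a proper map. -/
def PHtpc {X Y : Type*} [TopologicalSpace X] [TopologicalSpace Y] (f g : X → Y) : Prop :=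
  ∃ H : X × I → Y, ProperCont H ∧ (∀ x, H (x, 0) = f x) ∧ (∀ x, H (x, 1) = g x)

/-- `φ` is a proper homotopy equivalence with proper homotopy inverse `ψ`. -/
def IsPHEPair {X Y : Type*} [TopologicalSpace X] [TopologicalSpace Y]
    (φ : X → Y) (ψ : Y → X) : Prop :=
  ProperCont φ ∧ ProperCont ψ ∧ PHtpc (ψ ∘ φ) id ∧ PHtpc (φ ∘ ψ) id

/-- `φ` is a proper homotopy equivalence (admitting some proper homotopy inverse). -/
def IsPHE {X Y : Type*} [TopologicalSpace X] [TopologicalSpace Y] (φ : X → Y) : Prop :=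
  ∃ ψ : Y → X, IsPHEPair φ ψ

/-- `X` and `Y` are properly homotopy equivalent. -/
def PHEquivalent (X Y : Type*) [TopologicalSpace X] [TopologicalSpace Y] : Prop :=
  ∃ φ : X → Y, IsPHE φ

/-- The standard Möbius band, realized as a subset of `ℝ³`. -/
def MobiusBand : Set (ℝ × ℝ × ℝ) :=
  {p | ∃ u v : ℝ, |v| ≤ 1 / 2 ∧
    p = ((1 + v * Real.cos (u / 2)) * Real.cos u,
         (1 + v * Real.cos (u / 2)) * Real.sin u,
         v * Real.sin (u / 2))}

/-- A surface: a connected, orientable (no embedded Möbius band), second-countable, Hausdorff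
topological 2-manifold, possibly with boundary (locally modeled on the closed half-plane). -/
structure IsSurface (S : Type*) [TopologicalSpace S] : Prop where
  connected : ConnectedSpace S
  t2 : T2Space S
  secondCountable : SecondCountableTopology S
  locallyHalfPlane : ∀ x : S, ∃ (U : Set S) (V : Set {p : ℝ × ℝ // 0 ≤ p.2}),
    IsOpen U ∧ x ∈ U ∧ IsOpen V ∧ Nonempty (↥U ≃ₜ ↥V)
  orientable : ¬ ∃ f : ↥MobiusBand → S, IsEmbedding f

/-- The boundary of a surface: the set of points having no open neighborhood
homeomorphic to `ℝ²`. -/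
def Bd (S : Type*) [TopologicalSpace S] : Set S :=
  {x | ¬ ∃ U : Set S, IsOpen U ∧ x ∈ U ∧ Nonempty (↥U ≃ₜ (ℝ × ℝ))}

/-- The unit circle in the plane. -/
def Circ : Set (ℝ × ℝ) := {p | p.1 ^ 2 + p.2 ^ 2 = 1}

/-- A simple closed curve in `S`: the image of a topological embedding of the circle. -/
def IsSimpleClosedCurve {S : Type*} [TopologicalSpace S] (α : Set S) : Prop :=
  ∃ f : ↥Circ → S, IsEmbedding f ∧ range f = α

/-- A boundary isolating curve: a simple closed curve `α ⊆ S ∖ ∂S` such that `S ∖ α` has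
exactly two connected components `Y` and `Z` with `Y ∩ ∂S ≠ ∅`, `Z ∩ ∂S = ∅`, and
`Z ∪ α` noncompact. -/
def IsBoundaryIsolating {S : Type*} [TopologicalSpace S] (α : Set S) : Prop :=
  IsSimpleClosedCurve α ∧ α ∩ Bd S = ∅ ∧
  ∃ Y Z : Set S, Y ≠ Z ∧
    (∀ C : Set S, (∃ x ∈ αᶜ, C = connectedComponentIn αᶜ x) ↔ (C = Y ∨ C = Z)) ∧
    (Y ∩ Bd S).Nonempty ∧ Z ∩ Bd S = ∅ ∧ ¬ IsCompact (Z ∪ α)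

/-- The open part of the parametrizing interval of an edge. -/
def edgeInt : Set I := {t : I | 0 < (t : ℝ) ∧ (t : ℝ) < 1}

/-- A graph: a connected, locally finite, Hausdorff, 1-dimensional CW complex, presented by a
closed discrete vertex set and a set of characteristic maps of edges. -/
structure IsGraph (Γ : Type*) [TopologicalSpace Γ] : Prop where
  connected : ConnectedSpace Γ
  t2 : T2Space Γ
  cell_structure : ∃ (V : Set Γ) (E : Set C(I, Γ)),
    IsClosed V ∧ DiscreteTopology ↥V ∧
    (∀ e ∈ E, e 0 ∈ V ∧ e 1 ∈ V) ∧
    (∀ e ∈ E, IsEmbedding (fun t : ↥edgeInt => e t.1)) ∧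
    (∀ e ∈ E, (⇑e '' edgeInt) ∩ V = ∅) ∧
    (∀ e ∈ E, ∀ e' ∈ E, e ≠ e' → (⇑e '' edgeInt) ∩ (⇑e' '' edgeInt) = ∅) ∧
    (V ∪ ⋃ e ∈ E, ⇑e '' edgeInt) = univ ∧
    (∀ x : Γ, ∃ U : Set Γ, IsOpen U ∧ x ∈ U ∧ {e ∈ E | (range ⇑e ∩ U).Nonempty}.Finite) ∧
    (∀ A : Set Γ, (∀ e ∈ E, IsClosed (⇑e ⁻¹' A)) → IsClosed (A ∩ ⋃ e ∈ E, range ⇑e)) ∧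
    (∀ v ∈ V, (∃ e ∈ E, v ∈ range ⇑e) ∨ (univ : Set Γ) = {v})

/-- A finite graph: a graph with finitely many cells, equivalently a compact graph. -/
def IsFiniteGraph (Γ : Type*) [TopologicalSpace Γ] : Prop :=
  IsGraph Γ ∧ CompactSpace Γ

/-- A deformation retraction of `S` onto the subspace `A`. -/
def IsDeformationRetraction {S : Type*} [TopologicalSpace S] (H : S × I → S) (A : Set S) :
    Prop :=
  Continuous H ∧ (∀ x, H (x, 0) = x) ∧ (∀ x, H (x, 1) ∈ A) ∧ (∀ a ∈ A, H (a, 1) = a)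

/-- A proper deformation retraction of `S` onto the subspace `A`. -/
def IsProperDeformationRetraction {S : Type*} [TopologicalSpace S] (H : S × I → S)
    (A : Set S) : Prop :=
  ProperCont H ∧ (∀ x, H (x, 0) = x) ∧ (∀ x, H (x, 1) ∈ A) ∧ (∀ a ∈ A, H (a, 1) = a)

/-- An end of a space, recorded as a compatible choice of a connected component of the
complement of each compact set. -/
def IsEndFn {Γ : Type*} [TopologicalSpace Γ] (s : Set Γ → Set Γ) : Prop :=
  (∀ K : Set Γ, IsCompact K → ∃ x ∈ Kᶜ, s K = connectedComponentIn Kᶜ x) ∧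
  (∀ K K' : Set Γ, IsCompact K → IsCompact K' → K ⊆ K' → s K' ⊆ s K)

/-- A proper map induces the identity on the space of ends. -/
def InducesIdOnEnds {Γ : Type*} [TopologicalSpace Γ] (g : Γ → Γ) : Prop :=
  ∀ s : Set Γ → Set Γ, IsEndFn s → ∀ K : Set Γ, IsCompact K →
    ∃ K' : Set Γ, IsCompact K' ∧ K ⊆ K' ∧ g '' s K' ⊆ s K

/-- An isotopy between `f` and `g` relative to the set `B`: a homotopy each of whose time
slices is a homeomorphism fixing `B` pointwise. -/
def IsotopicRel {S : Type*} [TopologicalSpace S] (B : Set S) (f g : S → S) : Prop :=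
  ∃ H : S × I → S, Continuous H ∧ (∀ x, H (x, 0) = f x) ∧ (∀ x, H (x, 1) = g x) ∧
    ∀ t : I, IsHomeomorph (fun x => H (x, t)) ∧ ∀ x ∈ B, H (x, t) = x

/-- An isotopy between `f` and `g`: a homotopy each of whose time slices is a
homeomorphism. -/
def Isotopic {S : Type*} [TopologicalSpace S] (f g : S → S) : Prop :=
  ∃ H : S × I → S, Continuous H ∧ (∀ x, H (x, 0) = f x) ∧ (∀ x, H (x, 1) = g x) ∧
    ∀ t : I, IsHomeomorph (fun x => H (x, t))

/-- Representatives for the mapping class group of a surface: homeomorphisms fixing the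
boundary pointwise, with the compact-open topology. -/
abbrev MCGRep (S : Type*) [TopologicalSpace S] :=
  {f : C(S, S) // IsHomeomorph ⇑f ∧ ∀ x ∈ Bd S, f x = x}

/-- The isotopy-rel-boundary relation on representatives. -/
def mcgRel (S : Type*) [TopologicalSpace S] (f g : MCGRep S) : Prop :=
  IsotopicRel (Bd S) ⇑f.1 ⇑g.1

/-- The mapping class group `Map(S)` of a surface as a topological space: homeomorphisms
fixing the boundary pointwise, modulo isotopy rel boundary, with the quotient of the
compact-open topology. -/
abbrev MCG (S : Type*) [TopologicalSpace S] := Quot (mcgRel S)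

/-- Representatives for the extended mapping class group: all homeomorphisms. -/
abbrev ExRep (S : Type*) [TopologicalSpace S] := {f : C(S, S) // IsHomeomorph ⇑f}

/-- The (free) isotopy relation on representatives. -/
def exRel (S : Type*) [TopologicalSpace S] (f g : ExRep S) : Prop :=
  Isotopic ⇑f.1 ⇑g.1

/-- The extended mapping class group `ExMap(S)` as a topological space. -/
abbrev ExMCG (S : Type*) [TopologicalSpace S] := Quot (exRel S)

/-- Representatives for the mapping class group of a graph: proper homotopy equivalences
admitting a proper homotopy inverse, with the compact-open topology. -/
abbrev GphRep (Γ : Type*) [TopologicalSpace Γ] := {g : C(Γ, Γ) // IsPHE ⇑g}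

/-- The proper homotopy relation on representatives. -/
def gphRel (Γ : Type*) [TopologicalSpace Γ] (g h : GphRep Γ) : Prop :=
  PHtpc ⇑g.1 ⇑h.1

/-- The mapping class group `Map(Γ)` of a graph as a topological space. -/
abbrev GphMCG (Γ : Type*) [TopologicalSpace Γ] := Quot (gphRel Γ)

/-- Rotation of the unit circle by angle `a`. -/
def rotC (a : ℝ) (p : ↥Circ) : ↥Circ :=
  ⟨(p.1.1 * Real.cos a - p.1.2 * Real.sin a, p.1.1 * Real.sin a + p.1.2 * Real.cos a), by
    have h : p.1.1 ^ 2 + p.1.2 ^ 2 = 1 := p.2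
    have h2 := Real.sin_sq_add_cos_sq a
    simp only [Circ, Set.mem_setOf_eq]
    nlinarith [h, h2]⟩

/-- Reflection of the unit circle (the standard orientation-reversing involution). -/
def circConj (p : ↥Circ) : ↥Circ :=
  ⟨(p.1.1, -p.1.2), by
    have h : p.1.1 ^ 2 + p.1.2 ^ 2 = 1 := p.2
    simp only [Circ, Set.mem_setOf_eq]
    nlinarith [h]⟩

/-- The midpoint of the unit interval. -/
def ihalf : I := ⟨1 / 2, by norm_num [Set.mem_Icc]⟩

/-- `f` is the twist map determined by an embedded annular collar `e`:
`e(θ,t) ↦ e(θ + 2πt, t)` on the image of `e` and the identity elsewhere. -/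
def IsTwistMap {S : Type*} [TopologicalSpace S] (e : ↥Circ × I → S) (f : S → S) : Prop :=
  IsEmbedding e ∧
  (∀ (θ : ↥Circ) (t : I), f (e (θ, t)) = e (rotC (2 * Real.pi * (t : ℝ)) θ, t)) ∧
  (∀ x, x ∉ range e → f x = x)

/-- A Dehn twist about a compact boundary component of `S`. -/
def IsCptBdTwist {S : Type*} [TopologicalSpace S] (f : S → S) : Prop :=
  ∃ e : ↥Circ × I → S, IsTwistMap e f ∧
    (∃ x ∈ Bd S, range (fun θ : ↥Circ => e (θ, 0)) = connectedComponentIn (Bd S) x ∧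
      IsCompact (connectedComponentIn (Bd S) x)) ∧
    (∀ (θ : ↥Circ) (t : I), (t : ℝ) ≠ 0 → e (θ, t) ∉ Bd S)

/-- The closed unit disk in the plane. -/
def ClosedDisk : Set (ℝ × ℝ) := {p | p.1 ^ 2 + p.2 ^ 2 ≤ 1}

/-- A Dehn twist about a degenerate boundary chain: a twist supported in an annulus disjoint
from `∂S` whose core curve cuts off a piece homeomorphic to a closed disk with a nonempty
proper closed subset removed from its boundary circle. -/
def IsDegChainTwist {S : Type*} [TopologicalSpace S] (f : S → S) : Prop :=
  ∃ e : ↥Circ × I → S, IsTwistMap e f ∧ range e ∩ Bd S = ∅ ∧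
    ∃ x ∈ (range fun θ : ↥Circ => e (θ, ihalf))ᶜ,
      ∃ J : Set (ℝ × ℝ), J ⊆ Circ ∧ IsClosed J ∧ J.Nonempty ∧ J ≠ Circ ∧
        Nonempty
          (↥(closure (connectedComponentIn (range fun θ : ↥Circ => e (θ, ihalf))ᶜ x)) ≃ₜ
            ↥(ClosedDisk \ J))

/-- `f` is a finite composition of maps satisfying the predicate `P`. -/
def IsProductOf {S : Type*} [TopologicalSpace S] (P : (S → S) → Prop) (f : S → S) : Prop :=
  ∃ L : List (S → S), (∀ g ∈ L, P g) ∧ f = L.foldr (· ∘ ·) id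

/-- The closed half-strip `[0,∞) × [0,1]`. -/
def HalfStrip : Set (ℝ × ℝ) := {p | 0 ≤ p.1 ∧ 0 ≤ p.2 ∧ p.2 ≤ 1}

/-- The closed strip `ℝ × [0,1]`. -/
def FullStrip : Set (ℝ × ℝ) := {p | 0 ≤ p.2 ∧ p.2 ≤ 1}

/-- A closed annulus in the plane. -/
def AnnulusSet : Set (ℝ × ℝ) := {p | 1 ≤ p.1 ^ 2 + p.2 ^ 2 ∧ p.1 ^ 2 + p.2 ^ 2 ≤ 4}

/-- A surface is sporadic if it is homeomorphic to the closed disk, the half-strip, the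
strip, or the annulus. -/
def IsSporadic (S : Type*) [TopologicalSpace S] : Prop :=
  Nonempty (S ≃ₜ ↥ClosedDisk) ∨ Nonempty (S ≃ₜ ↥HalfStrip) ∨
    Nonempty (S ≃ₜ ↥FullStrip) ∨ Nonempty (S ≃ₜ ↥AnnulusSet)

/-- A parametrization of a compact boundary component of `S` by the circle. -/
def IsCptBdParam {S : Type*} [TopologicalSpace S] (β : ↥Circ → S) : Prop :=
  IsEmbedding β ∧ ∃ x ∈ Bd S, range β = connectedComponentIn (Bd S) x ∧
    IsCompact (range β)

/-- A proper parametrization of a noncompact boundary component of `S` by the line. -/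
def IsNcptBdParam {S : Type*} [TopologicalSpace S] (β : ℝ → S) : Prop :=
  IsEmbedding β ∧ ProperCont β ∧ ∃ x ∈ Bd S, range β = connectedComponentIn (Bd S) x ∧
    ¬ IsCompact (range β)

/-- `g` fixes (up to homotopy, resp. proper homotopy, and preserving orientations) each
curve and line of the collection `B` of `φ'`-images of boundary components:
membership in `Map(Γ, B)`. -/
def FixesBdryImages {S : Type*} [TopologicalSpace S] (G : Set S) (φ' : S → ↥G)
    (g : ↥G → ↥G) : Prop :=
  (∀ β : ↥Circ → S, IsCptBdParam β → Htpc (g ∘ φ' ∘ β) (φ' ∘ β)) ∧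
  (∀ β : ℝ → S, IsNcptBdParam β → PHtpc (g ∘ φ' ∘ β) (φ' ∘ β))

/-- `g` preserves the collection `B` of `φ'`-images of boundary components, possibly
permuting its members and reversing orientations: membership in `Map*(Γ, B)`. -/
def PermutesBdryImages {S : Type*} [TopologicalSpace S] (G : Set S) (φ' : S → ↥G)
    (g : ↥G → ↥G) : Prop :=
  (∀ β : ↥Circ → S, IsCptBdParam β → ∃ β' : ↥Circ → S, IsCptBdParam β' ∧
    (Htpc (g ∘ φ' ∘ β) (φ' ∘ β') ∨ Htpc (g ∘ φ' ∘ β) (φ' ∘ β' ∘ circConj))) ∧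
  (∀ β : ℝ → S, IsNcptBdParam β → ∃ β' : ℝ → S, IsNcptBdParam β' ∧
    (PHtpc (g ∘ φ' ∘ β) (φ' ∘ β') ∨ PHtpc (g ∘ φ' ∘ β) (φ' ∘ β' ∘ (fun r : ℝ => -r))))

end

theorem ProperCont.comp {X Y Z : Type*} [TopologicalSpace X] [TopologicalSpace Y]
    [TopologicalSpace Z] {g : Y → Z} {f : X → Y} (hg : ProperCont g) (hf : ProperCont f) :
    ProperCont (g ∘ f) :=
  ⟨hg.1.comp hf.1, fun K hK => hf.2 _ (hg.2 K hK)⟩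

theorem IsHomeomorph.properCont {X Y : Type*} [TopologicalSpace X] [TopologicalSpace Y]
    {f : X → Y} (hf : IsHomeomorph f) : ProperCont f :=
  ⟨hf.continuous, fun _ hK => (hf.homeomorph f).isCompact_preimage.2 hK⟩

/-- The product of a proper map to a Hausdorff space with the time reversal of the unit interval
is proper. -/
theorem ProperCont.prodMap_symm {X Y : Type*} [TopologicalSpace X] [TopologicalSpace Y]
    [T2Space Y] {f : X → Y} (hf : ProperCont f) :
    ProperCont (Prod.map f σ : X × I → Y × I) := by
  have hc : Continuous (Prod.map f σ : X × I → Y × I) := hf.1.prodMap continuous_symm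
  refine ⟨hc, fun K hK => ?_⟩
  refine ((hf.2 _ (hK.image continuous_fst)).prod isCompact_univ).of_isClosed_subset
    (hK.isClosed.preimage hc) ?_
  rintro ⟨x, t⟩ h
  exact ⟨⟨_, h, rfl⟩, mem_univ _⟩

/-- The time-one map of a proper deformation retraction is proper. -/
theorem IsProperDeformationRetraction.properCont_retraction {S : Type*} [TopologicalSpace S]
    {G : Set S} {H : S × I → S} (hH : IsProperDeformationRetraction H G)
    {r : S → ↥G} (hr : ∀ x, (r x : S) = H (x, 1)) : ProperCont r := by
  refine ⟨?_, fun K hK => ?_⟩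
  · rw [continuous_induced_rng]
    exact (hH.1.1.comp (by fun_prop : Continuous fun x : S => (x, (1 : I)))).congr
      fun x => (hr x).symm
  · have hC := (hH.1.2 _ (hK.image continuous_subtype_val)).inter_right
      (isClosed_singleton.preimage continuous_snd : IsClosed (Prod.snd ⁻¹' {(1 : I)} : Set (S × I)))
    convert hC.image continuous_fst using 1
    ext x
    constructor
    · intro hx
      exact ⟨(x, 1), ⟨⟨r x, hx, hr x⟩, rfl⟩, rfl⟩
    · rintro ⟨⟨y, t⟩, ⟨⟨k, hk, hky⟩, rfl : t = 1⟩, rfl⟩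
      have : k = r y := Subtype.ext (hky.trans (hr y).symm)
      exact mem_preimage.2 (this ▸ hk)

theorem Homeomorph.map_mem_Bd {X Y : Type*} [TopologicalSpace X] [TopologicalSpace Y]
    (e : X ≃ₜ Y) {x : X} (hx : x ∈ Bd X) : e x ∈ Bd Y := by
  rintro ⟨U, hU, hxU, ⟨u⟩⟩
  exact hx ⟨e ⁻¹' U, hU.preimage e.continuous, hxU,
    ⟨(e.sets (s := e ⁻¹' U) (t := U) rfl).trans u⟩⟩

theorem Homeomorph.image_Bd {X Y : Type*} [TopologicalSpace X] [TopologicalSpace Y]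
    (e : X ≃ₜ Y) : e '' Bd X = Bd Y := by
  refine Subset.antisymm (image_subset_iff.2 fun x hx => e.map_mem_Bd hx) fun y hy => ?_
  exact ⟨e.symm y, e.symm.map_mem_Bd hy, e.apply_symm_apply y⟩

/-- A homeomorphism carries boundary components to boundary components. -/
theorem IsHomeomorph.exists_range_comp_eq_component {S X : Type*} [TopologicalSpace S] {f : S → S}
    (hf : IsHomeomorph f) {β : X → S}
    (hβ : ∃ x ∈ Bd S, range β = connectedComponentIn (Bd S) x) :
    ∃ x ∈ Bd S, range (f ∘ β) = connectedComponentIn (Bd S) x := by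
  obtain ⟨x, hx, hr⟩ := hβ
  let e := hf.homeomorph f
  refine ⟨e x, e.map_mem_Bd hx, ?_⟩
  rw [range_comp, hr]
  exact (e.image_connectedComponentIn hx).trans (by rw [e.image_Bd])

theorem IsHomeomorph.isCompact_range_comp_iff {X S T : Type*} [TopologicalSpace S]
    [TopologicalSpace T] {f : S → T} (hf : IsHomeomorph f) {β : X → S} :
    IsCompact (range (f ∘ β)) ↔ IsCompact (range β) := by
  rw [range_comp]
  exact (hf.homeomorph f).isCompact_image

theorem IsCptBdParam.comp_isHomeomorph {S : Type*} [TopologicalSpace S] {f : S → S}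
    (hf : IsHomeomorph f) {β : ↥Circ → S} (hβ : IsCptBdParam β) : IsCptBdParam (f ∘ β) := by
  obtain ⟨he, x, hx, hr, hK⟩ := hβ
  obtain ⟨y, hy, hry⟩ := hf.exists_range_comp_eq_component ⟨x, hx, hr⟩
  exact ⟨hf.isEmbedding.comp he, y, hy, hry, hf.isCompact_range_comp_iff.2 hK⟩

theorem IsNcptBdParam.comp_isHomeomorph {S : Type*} [TopologicalSpace S] {f : S → S}
    (hf : IsHomeomorph f) {β : ℝ → S} (hβ : IsNcptBdParam β) : IsNcptBdParam (f ∘ β) := by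
  obtain ⟨he, hp, x, hx, hr, hK⟩ := hβ
  obtain ⟨y, hy, hry⟩ := hf.exists_range_comp_eq_component ⟨x, hx, hr⟩
  exact ⟨hf.isEmbedding.comp he, hf.properCont.comp hp, y, hy, hry,
    fun h => hK (hf.isCompact_range_comp_iff.1 h)⟩

theorem IsCptBdParam.mem_Bd {S : Type*} [TopologicalSpace S] {β : ↥Circ → S}
    (hβ : IsCptBdParam β) (s : ↥Circ) : β s ∈ Bd S := by
  obtain ⟨-, x, -, hr, -⟩ := hβ
  exact connectedComponentIn_subset _ _ (hr ▸ mem_range_self s)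

theorem IsNcptBdParam.mem_Bd {S : Type*} [TopologicalSpace S] {β : ℝ → S}
    (hβ : IsNcptBdParam β) (s : ℝ) : β s ∈ Bd S := by
  obtain ⟨-, -, x, -, hr, -⟩ := hβ
  exact connectedComponentIn_subset _ _ (hr ▸ mem_range_self s)

section Retraction

variable {S : Type*} [TopologicalSpace S] {G : Set S} {H : S × I → S}
  {r : S → ↥G} {f : S → S} {X : Type*} [TopologicalSpace X] {β : X → S}

/-- Running the retraction backwards in time and applying `r ∘ f` is a homotopy from
`(r ∘ f ∘ Subtype.val) ∘ r ∘ β` to `r ∘ f ∘ β`. -/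
theorem IsProperDeformationRetraction.htpc_comp (hH : IsProperDeformationRetraction H G)
    (hr : ∀ x, (r x : S) = H (x, 1)) (hf : Continuous f) (hβ : Continuous β) :
    Htpc ((r ∘ f ∘ (Subtype.val : ↥G → S)) ∘ r ∘ β) (r ∘ f ∘ β) :=
  ⟨r ∘ f ∘ H ∘ Prod.map β σ,
    (hH.properCont_retraction hr).1.comp
      (hf.comp (hH.1.1.comp (hβ.prodMap continuous_symm))),
    fun x => by simp [hr], fun x => by simp [hH.2.1]⟩

theorem IsProperDeformationRetraction.phtpc_comp [T2Space S]
    (hH : IsProperDeformationRetraction H G)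
    (hr : ∀ x, (r x : S) = H (x, 1)) (hf : ProperCont f) (hβ : ProperCont β) :
    PHtpc ((r ∘ f ∘ (Subtype.val : ↥G → S)) ∘ r ∘ β) (r ∘ f ∘ β) :=
  ⟨r ∘ f ∘ H ∘ Prod.map β σ,
    (hH.properCont_retraction hr).comp (hf.comp (hH.1.comp hβ.prodMap_symm)),
    fun x => by simp [hr], fun x => by simp [hH.2.1]⟩

end Retraction

/-- Let `S` be a surface with nonempty boundary and no boundary isolating
curve, `φ'` the time-one map of a proper deformation retraction of `S` onto a graph
`G ⊆ S`, and `B` the collection of `φ'`-images of parametrized boundary components of `S`.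
Then the image of `Θ : Map(S) → Map(G)` is contained in `Map(G, B)` and the image of
`Θ̃ : ExMap(S) → Map(G)` is contained in `Map*(G, B)`. -/
theorem induced_image_fixes_boundary_curves (S : Type*) [TopologicalSpace S]
    (hS : IsSurface S) (hbd : (Bd S).Nonempty)
    (hbi : ¬ ∃ α : Set S, IsBoundaryIsolating α)
    (G : Set S) (hG : IsGraph ↥G) (H : S × I → S)
    (hH : IsProperDeformationRetraction H G)
    (φ' : S → ↥G) (hφ' : ∀ x, (φ' x : S) = H (x, 1)) :
    (∀ f : S → S, IsHomeomorph f → (∀ x ∈ Bd S, f x = x) →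
      FixesBdryImages G φ' (φ' ∘ f ∘ (Subtype.val : ↥G → S))) ∧
    (∀ f : S → S, IsHomeomorph f →
      PermutesBdryImages G φ' (φ' ∘ f ∘ (Subtype.val : ↥G → S))) := by
  have : T2Space S := hS.t2
  refine ⟨fun f hf hfix => ⟨fun β hβ => ?_, fun β hβ => ?_⟩,
    fun f hf => ⟨fun β hβ => ?_, fun β hβ => ?_⟩⟩
  · have hfβ : f ∘ β = β := funext fun s => hfix _ (hβ.mem_Bd s)
    have := hH.htpc_comp hφ' hf.continuous hβ.1.continuous
    rwa [hfβ] at this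
  · have hfβ : f ∘ β = β := funext fun s => hfix _ (hβ.mem_Bd s)
    have := hH.phtpc_comp hφ' hf.properCont hβ.2.1
    rwa [hfβ] at this
  · exact ⟨f ∘ β, hβ.comp_isHomeomorph hf,
      Or.inl (hH.htpc_comp hφ' hf.continuous hβ.1.continuous)⟩
  · exact ⟨f ∘ β, hβ.comp_isHomeomorph hf,
      Or.inl (hH.phtpc_comp hφ' hf.properCont hβ.2.1)⟩
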